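/- Let n ≥ 2. There exist constants c, C > 0, depending only on n, such that for every integer k ≥ 1: c · k^{(n−1)/4} ≤ (sup_{x ∈ Sⁿ} |Re((x₁ + i x₂)^k)|) / (∫_{Sⁿ} (Re((x₁ + i x₂)^k))² dσ(x))^{1/2} ≤ C · k^{(n−1)/4}. (That is, the L²-normalized highest weight spherical harmonic of degree k has sup-norm comparable to k^{(n−1)/4}.) -/

import Mathlib

open MeasureTheory Complex

/-- Integrating a homogeneous function against the Gaussian `exp (-‖x‖ ^ 2)` reduces to an
integral over the unit sphere. -/
lemma integral_homogeneous_mul_exp_neg_norm_sq {E : Type*} [NormedAddCommGroup E]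
    [NormedSpace ℝ E] [MeasurableSpace E] [BorelSpace E] [FiniteDimensional ℝ E] [Nontrivial E]
    (μ : Measure E) [μ.IsAddHaarMeasure] {P : E → ℝ} {p : ℕ}
    (hP : ∀ (r : ℝ) (x : E), 0 < r → P (r • x) = r ^ p * P x) :
    ∫ x, P x * Real.exp (-‖x‖ ^ 2) ∂μ =
      (∫ x : Metric.sphere (0 : E) 1, P x ∂μ.toSphere) *
        (Real.Gamma (((p : ℝ) + Module.finrank ℝ E) / 2) / 2) := by
  set d := Module.finrank ℝ E with hd
  have hdpos : 0 < d := Module.finrank_pos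
  calc
    ∫ x, P x * Real.exp (-‖x‖ ^ 2) ∂μ
      = ∫ x : ({(0)}ᶜ : Set E), P x * Real.exp (-‖x.1‖ ^ 2) ∂(μ.comap (↑)) := by
        rw [integral_subtype_comap (measurableSet_singleton _).compl
          fun x ↦ P x * Real.exp (-‖x‖ ^ 2), restrict_compl_singleton]
    _ = ∫ x, P x.1 * ((x.2 : ℝ) ^ p * Real.exp (-(x.2 : ℝ) ^ 2))
          ∂μ.toSphere.prod (.volumeIoiPow (d - 1)) := by
        rw [← μ.measurePreserving_homeomorphUnitSphereProd.integral_comp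
          (Homeomorph.measurableEmbedding _)]
        refine integral_congr_ae (.of_forall fun x ↦ ?_)
        have hx : 0 < ‖(x : E)‖ := norm_pos_iff.2 x.2
        have h := hP ‖(x : E)‖ (‖(x : E)‖⁻¹ • x) hx
        rw [smul_inv_smul₀ hx.ne'] at h
        simp only [homeomorphUnitSphereProd_apply_snd_coe, homeomorphUnitSphereProd_apply_fst_coe]
        rw [h]
        ring
    _ = (∫ x : Metric.sphere (0 : E) 1, P x ∂μ.toSphere) *
          ∫ r : Set.Ioi (0 : ℝ), (r : ℝ) ^ p * Real.exp (-(r : ℝ) ^ 2)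
            ∂.volumeIoiPow (d - 1) :=
        integral_prod_mul (fun x : Metric.sphere (0 : E) 1 ↦ P x)
          (fun r : Set.Ioi (0 : ℝ) ↦ (r : ℝ) ^ p * Real.exp (-(r : ℝ) ^ 2))
    _ = _ := by
        congr 1
        simp only [Measure.volumeIoiPow, ENNReal.ofReal]
        rw [integral_withDensity_eq_integral_smul
            (measurable_subtype_coe.pow_const _).real_toNNReal,
          integral_subtype_comap measurableSet_Ioi fun a : ℝ ↦
            Real.toNNReal (a ^ (d - 1)) • (a ^ p * Real.exp (-a ^ 2))]
        have h := integral_rpow_mul_exp_neg_rpow (p := 2) (q := ((p + (d - 1) : ℕ) : ℝ))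
          two_pos (by linarith [Nat.cast_nonneg (α := ℝ) (p + (d - 1))])
        have hq : (((p + (d - 1) : ℕ) : ℝ) + 1) = p + d := by
          rw [← Nat.cast_add_one, add_assoc, Nat.sub_add_cancel hdpos, Nat.cast_add]
        rw [hq] at h
        rw [div_eq_inv_mul, ← one_div, ← h]
        refine setIntegral_congr_fun measurableSet_Ioi fun x hx ↦ ?_
        have hx' : (0 : ℝ) < x := hx
        simp only [NNReal.smul_def, Real.coe_toNNReal _ (pow_nonneg hx'.le _), smul_eq_mul,
          Real.rpow_natCast, Real.rpow_two]
        rw [pow_add]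
        ring

/-- The Gaussian integral of `Re ((x + i y) ^ k) ^ 2` over the plane. -/
lemma integral_re_pow_sq_mul_exp_neg (k : ℕ) (hk : 1 ≤ k) :
    ∫ p : ℝ × ℝ, (((p.1 : ℂ) + (p.2 : ℂ) * I) ^ k).re ^ 2 * Real.exp (-(p.1 ^ 2 + p.2 ^ 2)) =
      Real.pi * (Real.Gamma (k + 1) / 2) := by
  rw [← integral_comp_polarCoord_symm]
  calc
    _ = ∫ p in Set.Ioi (0 : ℝ) ×ˢ Set.Ioo (-Real.pi) Real.pi,
          (p.1 ^ ((2 * k + 1 : ℕ) : ℝ) * Real.exp (-p.1 ^ (2 : ℝ))) *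
            Real.cos (k * p.2) ^ 2 := by
        refine setIntegral_congr_fun (measurableSet_Ioi.prod measurableSet_Ioo) fun p _ ↦ ?_
        have hre : ((((p.1 * Real.cos p.2 : ℝ) : ℂ) + ((p.1 * Real.sin p.2 : ℝ) : ℂ) * I) ^ k).re
            = p.1 ^ k * Real.cos (k * p.2) := by
          have : (((p.1 * Real.cos p.2 : ℝ) : ℂ) + ((p.1 * Real.sin p.2 : ℝ) : ℂ) * I) ^ k
              = ((p.1 ^ k : ℝ) : ℂ) *
                (((Real.cos (k * p.2) : ℝ) : ℂ) + ((Real.sin (k * p.2) : ℝ) : ℂ) * I) := by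
            push_cast
            rw [← Complex.cos_add_sin_mul_I_pow, ← mul_pow]
            ring
          rw [this, Complex.re_ofReal_mul]
          simp only [Complex.add_re, Complex.ofReal_re, Complex.re_ofReal_mul, Complex.I_re,
            mul_zero, add_zero]
        have hsq : (p.1 * Real.cos p.2) ^ 2 + (p.1 * Real.sin p.2) ^ 2 = p.1 ^ 2 := by
          rw [mul_pow, mul_pow, ← mul_add, Real.cos_sq_add_sin_sq, mul_one]
        simp only [polarCoord_symm_apply, hre, hsq, smul_eq_mul, Real.rpow_natCast, Real.rpow_two]
        ring
    _ = (∫ r in Set.Ioi (0 : ℝ), r ^ ((2 * k + 1 : ℕ) : ℝ) * Real.exp (-r ^ (2 : ℝ))) *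
          ∫ t in Set.Ioo (-Real.pi) Real.pi, Real.cos (k * t) ^ 2 := by
        rw [Measure.volume_eq_prod]
        exact setIntegral_prod_mul
          (fun r : ℝ ↦ r ^ ((2 * k + 1 : ℕ) : ℝ) * Real.exp (-r ^ (2 : ℝ)))
          (fun t : ℝ ↦ Real.cos (k * t) ^ 2) _ _
    _ = _ := by
        have hk0 : (k : ℝ) ≠ 0 := by positivity
        rw [integral_rpow_mul_exp_neg_rpow two_pos
          (by linarith [Nat.cast_nonneg (α := ℝ) (2 * k + 1)]),
          ← integral_Ioc_eq_integral_Ioo,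
          ← intervalIntegral.integral_of_le (by linarith [Real.pi_pos]),
          intervalIntegral.integral_comp_mul_left (fun t ↦ Real.cos t ^ 2) hk0, integral_cos_sq]
        have hG : (((2 * k + 1 : ℕ) : ℝ) + 1) / 2 = k + 1 := by
          push_cast
          ring
        rw [hG, mul_neg, Real.sin_neg, Real.sin_nat_mul_pi]
        simp only [smul_eq_mul]
        field_simp
        ring

/-- A function of the first two coordinates integrates against the Gaussian on
`EuclideanSpace ℝ (Fin (m + 2))` as on the plane, up to a power of `√π`. -/
lemma integral_two_coords_mul_exp_neg_norm_sq (m : ℕ) (g : ℝ → ℝ → ℝ) :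
    ∫ x : EuclideanSpace ℝ (Fin (m + 2)), g (x 0) (x 1) * Real.exp (-‖x‖ ^ 2) =
      (∫ p : ℝ × ℝ, g p.1 p.2 * Real.exp (-(p.1 ^ 2 + p.2 ^ 2))) * √Real.pi ^ m := by
  have e₁ := volume_preserving_piFinSuccAbove (fun _ : Fin (m + 2) ↦ ℝ) 0
  have e₂ : MeasurePreserving
      (Prod.map id (MeasurableEquiv.piFinSuccAbove (fun _ : Fin (m + 1) ↦ ℝ) 0)) volume volume :=
    (MeasurePreserving.id (volume : Measure ℝ)).prod
      (volume_preserving_piFinSuccAbove (fun _ : Fin (m + 1) ↦ ℝ) 0)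
  have e₃ := (volume_preserving_prodAssoc (α₁ := ℝ) (β₁ := ℝ) (γ₁ := Fin m → ℝ)).symm
  rw [← (PiLp.volume_preserving_toLp (Fin (m + 2))).integral_comp
    (MeasurableEquiv.toLp 2 (Fin (m + 2) → ℝ)).measurableEmbedding]
  calc
    _ = ∫ y : (ℝ × ℝ) × (Fin m → ℝ), (g y.1.1 y.1.2 * Real.exp (-(y.1.1 ^ 2 + y.1.2 ^ 2))) *
          ∏ i, Real.exp (-1 * y.2 i ^ 2) := by
        rw [← e₃.integral_comp',
          ← e₂.integral_comp
            ((MeasurableEquiv.refl ℝ).prodCongr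
              (MeasurableEquiv.piFinSuccAbove (fun _ : Fin (m + 1) ↦ ℝ) 0)).measurableEmbedding,
          ← e₁.integral_comp']
        refine integral_congr_ae (.of_forall fun x ↦ ?_)
        have hcoord : MeasurableEquiv.prodAssoc.symm (Prod.map id
            (MeasurableEquiv.piFinSuccAbove (fun _ : Fin (m + 1) ↦ ℝ) 0)
            (MeasurableEquiv.piFinSuccAbove (fun _ : Fin (m + 2) ↦ ℝ) 0 x)) =
              ((x 0, x 1), fun i : Fin m ↦ x i.succ.succ) := rfl
        have hnorm : ‖(WithLp.toLp 2 x : EuclideanSpace ℝ (Fin (m + 2)))‖ ^ 2 =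
            x 0 ^ 2 + x 1 ^ 2 + ∑ i : Fin m, x i.succ.succ ^ 2 := by
          rw [EuclideanSpace.real_norm_sq_eq, Fin.sum_univ_succ, Fin.sum_univ_succ, ← add_assoc]
          rfl
        simp only [hcoord, hnorm, ← Real.exp_sum, mul_assoc, ← Real.exp_add, neg_one_mul,
          Finset.sum_neg_distrib, neg_add]
    _ = _ := by
        rw [Measure.volume_eq_prod (ℝ × ℝ)]
        rw [integral_prod_mul (fun p : ℝ × ℝ ↦ g p.1 p.2 * Real.exp (-(p.1 ^ 2 + p.2 ^ 2)))
          (fun z : Fin m → ℝ ↦ ∏ i, Real.exp (-1 * z i ^ 2)),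
          integral_fintype_prod_volume_eq_pow (fun t : ℝ ↦ Real.exp (-1 * t ^ 2)),
          integral_gaussian, Fintype.card_fin, div_one]

lemma Real.Gamma_add_half_le {x : ℝ} (hx : 0 < x) : Gamma (x + 1 / 2) ≤ √x * Gamma x := by
  have h := Gamma_mul_add_mul_le_rpow_Gamma_mul_rpow_Gamma (s := x) (t := x + 1)
    (a := 1 / 2) (b := 1 / 2) hx (by linarith) (by norm_num) (by norm_num) (by norm_num)
  have hG := Gamma_pos_of_pos hx
  rw [← Real.sqrt_eq_rpow, ← Real.sqrt_eq_rpow, Gamma_add_one hx.ne',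
    Real.sqrt_mul hx.le, mul_left_comm, Real.mul_self_sqrt hG.le] at h
  convert! h using 2
  ring

lemma Real.sqrt_mul_Gamma_le {x : ℝ} (hx : 1 / 2 < x) :
    √(x - 1 / 2) * Gamma x ≤ Gamma (x + 1 / 2) := by
  have hy : 0 < x - 1 / 2 := by linarith
  have h := Gamma_add_half_le hy
  have h1 := Gamma_add_one hy.ne'
  rw [sub_add_cancel] at h
  calc √(x - 1 / 2) * Gamma x ≤ √(x - 1 / 2) * (√(x - 1 / 2) * Gamma (x - 1 / 2)) := by gcongr
    _ = Gamma (x - 1 / 2 + 1) := by rw [h1, ← mul_assoc, Real.mul_self_sqrt hy.le]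
    _ = _ := by ring_nf

/-- Two-sided bound for the growth of `Gamma` under half-integer shifts. -/
lemma exists_Gamma_add_half_nat_bounds (j : ℕ) :
    ∃ C : ℝ, 0 < C ∧ ∀ k : ℕ, 1 ≤ k →
      √k ^ j * Real.Gamma (k + 1) ≤ Real.Gamma (k + 1 + j / 2) ∧
        Real.Gamma (k + 1 + j / 2) ≤ C * √k ^ j * Real.Gamma (k + 1) := by
  induction j with
  | zero => exact ⟨1, one_pos, fun k _ ↦ by simp⟩
  | succ j ih =>
    obtain ⟨C, hC, h⟩ := ih
    refine ⟨√(j + 2) * C, by positivity, fun k hk ↦ ?_⟩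
    obtain ⟨hl, hu⟩ := h k hk
    have hk1 : (1 : ℝ) ≤ k := by exact_mod_cast hk
    have hj : (0 : ℝ) ≤ j := j.cast_nonneg
    set x : ℝ := k + 1 + j / 2 with hx
    have hxs : (k : ℝ) + 1 + (j + 1 : ℕ) / 2 = x + 1 / 2 := by
      push_cast
      ring
    rw [hxs]
    constructor
    · calc √k ^ (j + 1) * Real.Gamma (k + 1) = √k * (√k ^ j * Real.Gamma (k + 1)) := by ring
        _ ≤ √(x - 1 / 2) * Real.Gamma x := by
          gcongr
          linarith
        _ ≤ _ := Real.sqrt_mul_Gamma_le (by linarith)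
    · calc Real.Gamma (x + 1 / 2) ≤ √x * Real.Gamma x := Real.Gamma_add_half_le (by linarith)
        _ ≤ √((j + 2) * k) * (C * √k ^ j * Real.Gamma (k + 1)) := by
          have : 0 < Real.Gamma x := Real.Gamma_pos_of_pos (by linarith)
          gcongr
          nlinarith
        _ = _ := by
          rw [Real.sqrt_mul (by positivity)]
          ring

/-- The squared `L²` norm of `Re ((x₁ + i x₂) ^ k)` on the unit sphere of `ℝ^(m + 2)`. -/
lemma integral_sphere_re_pow_sq (m k : ℕ) (hk : 1 ≤ k) :
    ∫ x : Metric.sphere (0 : EuclideanSpace ℝ (Fin (m + 2))) 1,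
      ((((x : EuclideanSpace ℝ (Fin (m + 2))) 0 : ℂ) +
        ((x : EuclideanSpace ℝ (Fin (m + 2))) 1 : ℂ) * I) ^ k).re ^ 2
        ∂((volume : Measure (EuclideanSpace ℝ (Fin (m + 2)))).toSphere) =
      Real.pi * √Real.pi ^ m * Real.Gamma (k + 1) / Real.Gamma (k + 1 + m / 2) := by
  have h₁ := integral_homogeneous_mul_exp_neg_norm_sq
    (volume : Measure (EuclideanSpace ℝ (Fin (m + 2)))) (p := 2 * k)
    (P := fun x ↦ (((x 0 : ℂ) + (x 1 : ℂ) * I) ^ k).re ^ 2) (fun r x _ ↦ by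
      have : (((r • x) 0 : ℝ) : ℂ) + (((r • x) 1 : ℝ) : ℂ) * I = r * (x 0 + x 1 * I) := by
        simp
        ring
      simp only [this]
      rw [mul_pow, ← Complex.ofReal_pow, Complex.re_ofReal_mul]
      ring)
  rw [integral_two_coords_mul_exp_neg_norm_sq m
    (fun a b ↦ (((a : ℂ) + (b : ℂ) * I) ^ k).re ^ 2), integral_re_pow_sq_mul_exp_neg k hk,
    finrank_euclideanSpace, Fintype.card_fin] at h₁
  have hG : (((2 * k : ℕ) : ℝ) + ((m + 2 : ℕ) : ℝ)) / 2 = k + 1 + m / 2 := by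
    push_cast
    ring
  rw [hG] at h₁
  have hpos : 0 < Real.Gamma (k + 1 + m / 2) := Real.Gamma_pos_of_pos (by positivity)
  rw [eq_div_iff hpos.ne']
  linarith

/-- `Re ((x₁ + i x₂) ^ k)` has supremum norm `1` on the unit sphere. -/
lemma iSup_sphere_abs_re_pow (m k : ℕ) :
    ⨆ x : Metric.sphere (0 : EuclideanSpace ℝ (Fin (m + 2))) 1,
      |((((x : EuclideanSpace ℝ (Fin (m + 2))) 0 : ℂ) +
        ((x : EuclideanSpace ℝ (Fin (m + 2))) 1 : ℂ) * I) ^ k).re| = 1 := by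
  have hle (x : Metric.sphere (0 : EuclideanSpace ℝ (Fin (m + 2))) 1) :
      |((((x : EuclideanSpace ℝ (Fin (m + 2))) 0 : ℂ) +
        ((x : EuclideanSpace ℝ (Fin (m + 2))) 1 : ℂ) * I) ^ k).re| ≤ 1 := by
    refine (Complex.abs_re_le_norm _).trans ?_
    rw [norm_pow]
    refine pow_le_one₀ (norm_nonneg _) ?_
    have hx : ‖(x : EuclideanSpace ℝ (Fin (m + 2)))‖ ^ 2 = 1 := by simp
    rw [EuclideanSpace.real_norm_sq_eq, Fin.sum_univ_succ, Fin.sum_univ_succ] at hx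
    rw [Complex.norm_add_mul_I, Real.sqrt_le_one]
    have : 0 ≤ ∑ i : Fin m, (x : EuclideanSpace ℝ (Fin (m + 2))) i.succ.succ ^ 2 := by positivity
    simp only [Fin.succ_zero_eq_one] at hx
    linarith
  have : Nonempty (Metric.sphere (0 : EuclideanSpace ℝ (Fin (m + 2))) 1) :=
    ⟨⟨EuclideanSpace.single 0 1, by simp⟩⟩
  refine le_antisymm (ciSup_le hle) ?_
  refine le_trans ?_ (le_ciSup (f := fun x : Metric.sphere (0 : EuclideanSpace ℝ (Fin (m + 2))) 1 ↦
    |((((x : EuclideanSpace ℝ (Fin (m + 2))) 0 : ℂ) +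
        ((x : EuclideanSpace ℝ (Fin (m + 2))) 1 : ℂ) * I) ^ k).re|)
    ⟨1, Set.forall_mem_range.2 hle⟩ ⟨EuclideanSpace.single 0 1, by simp⟩)
  simp

/-- For `n ≥ 2` there are constants `c, C > 0` (depending only on `n`) such that
for every `k ≥ 1`,
`c * k^{(n-1)/4} ≤ (sup_{x ∈ Sⁿ} |Re((x₁+ix₂)^k)|) / (∫_{Sⁿ} (Re((x₁+ix₂)^k))² dσ)^{1/2}
  ≤ C * k^{(n-1)/4}`. -/
theorem stmt5 (n : ℕ) (hn : 2 ≤ n) :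
    ∃ c C : ℝ, 0 < c ∧ 0 < C ∧
      ∀ k : ℕ, 1 ≤ k →
        let sup : ℝ := ⨆ x : Metric.sphere (0 : EuclideanSpace ℝ (Fin (n + 1))) 1,
          |((((x : EuclideanSpace ℝ (Fin (n + 1))) 0 : ℂ) +
              ((x : EuclideanSpace ℝ (Fin (n + 1))) 1 : ℂ) * Complex.I) ^ k).re|
        let l2 : ℝ := Real.sqrt (∫ x : Metric.sphere (0 : EuclideanSpace ℝ (Fin (n + 1))) 1,
          ((((x : EuclideanSpace ℝ (Fin (n + 1))) 0 : ℂ) +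
              ((x : EuclideanSpace ℝ (Fin (n + 1))) 1 : ℂ) * Complex.I) ^ k).re ^ 2
            ∂((volume : Measure (EuclideanSpace ℝ (Fin (n + 1)))).toSphere))
        c * (k : ℝ) ^ (((n : ℝ) - 1) / 4) ≤ sup / l2 ∧
          sup / l2 ≤ C * (k : ℝ) ^ (((n : ℝ) - 1) / 4) := by
  obtain ⟨m, rfl⟩ : ∃ m, n = m + 1 := ⟨n - 1, by omega⟩
  obtain ⟨C, hC, hGamma⟩ := exists_Gamma_add_half_nat_bounds m
  set A : ℝ := Real.pi * √Real.pi ^ m with hA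
  have hApos : 0 < A := by positivity
  refine ⟨√A⁻¹, √(C / A), by positivity, by positivity, fun k hk ↦ ?_⟩
  intro sup l2
  have hsup : sup = 1 := iSup_sphere_abs_re_pow m k
  have hl2 : l2 = √(A * Real.Gamma (k + 1) / Real.Gamma (k + 1 + m / 2)) :=
    congrArg Real.sqrt (integral_sphere_re_pow_sq m k hk)
  obtain ⟨hl, hu⟩ := hGamma k hk
  have hG : 0 < Real.Gamma (k + 1) := Real.Gamma_pos_of_pos (by positivity)
  have hratio : sup / l2 = √(Real.Gamma (k + 1 + m / 2) / (A * Real.Gamma (k + 1))) := by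
    rw [hsup, hl2, one_div, ← Real.sqrt_inv, inv_div]
  have hpow : (k : ℝ) ^ ((((m + 1 : ℕ) : ℝ) - 1) / 4) = √(√k ^ m) := by
    rw [Real.sqrt_eq_rpow, Real.sqrt_eq_rpow, ← Real.rpow_natCast, ← Real.rpow_mul (by positivity),
      ← Real.rpow_mul (by positivity)]
    congr 1
    push_cast
    ring
  rw [hratio, hpow, ← Real.sqrt_mul (by positivity), ← Real.sqrt_mul (by positivity)]
  constructor
  · refine Real.sqrt_le_sqrt ?_
    rw [le_div_iff₀ (by positivity)]
    calc A⁻¹ * √k ^ m * (A * Real.Gamma (k + 1)) = √k ^ m * Real.Gamma (k + 1) := by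
          field_simp
      _ ≤ _ := hl
  · refine Real.sqrt_le_sqrt ?_
    rw [div_le_iff₀ (by positivity)]
    calc _ ≤ C * √k ^ m * Real.Gamma (k + 1) := hu
      _ = _ := by field_simp
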